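/- For all real numbers m and y with 0 < m < y < 1, the infimum over t > 0 of (m·e^t + 1 − m)·e^{−t·y} equals e^{−d_KL(y‖m)}, where d_KL(y‖m) := y·ln(y/m) + (1−y)·ln((1−y)/(1−m)); moreover the infimum is attained at t = ln( y(1−m) / (m(1−y)) ) > 0. -/

import Mathlib

noncomputable section

/-- The binary relative entropy (natural logarithm):
`d_KL(y‖m) = y ln (y/m) + (1-y) ln ((1-y)/(1-m))`. -/
def dKL (y m : ℝ) : ℝ :=
  y * Real.log (y / m) + (1 - y) * Real.log ((1 - y) / (1 - m))

/-- Chernoff lower bound: every value of the tilted moment generating function of a Bernoulli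
variable with mean `m` is at least `e^{-d_KL(y‖m)}`. -/
theorem exp_neg_dKL_le {m y : ℝ} (hm : 0 < m) (hm1 : m < 1) (hy0 : 0 < y) (hy : y < 1) (t : ℝ) :
    Real.exp (-dKL y m) ≤ (m * Real.exp t + 1 - m) * Real.exp (-t * y) := by
  have h1m : 0 < 1 - m := sub_pos.2 hm1
  have h1y : 0 < 1 - y := sub_pos.2 hy
  have key := convexOn_exp.2 (Set.mem_univ (t - Real.log (y / m)))
    (Set.mem_univ (-Real.log ((1 - y) / (1 - m)))) hy0.le h1y.le (by ring)
  simp only [smul_eq_mul] at key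
  rw [Real.exp_sub, Real.exp_neg (Real.log _), Real.exp_log (by positivity),
    Real.exp_log (by positivity)] at key
  have hsum : y * (Real.exp t / (y / m)) + (1 - y) * ((1 - y) / (1 - m))⁻¹
      = m * Real.exp t + 1 - m := by
    field_simp
    ring
  rw [hsum] at key
  calc Real.exp (-dKL y m)
      = Real.exp (y * (t - Real.log (y / m)) + (1 - y) * -Real.log ((1 - y) / (1 - m)))
          * Real.exp (-t * y) := by
        rw [← Real.exp_add, dKL]
        congr 1
        ring
    _ ≤ _ := by gcongr

/-- The tilted moment generating function takes the value `e^{-d_KL(y‖m)}` at the log odds ratio. -/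
theorem mgf_log_odds_ratio_eq {m y : ℝ} (hm : 0 < m) (hm1 : m < 1) (hy0 : 0 < y) (hy : y < 1) :
    (m * Real.exp (Real.log (y * (1 - m) / (m * (1 - y)))) + 1 - m) *
        Real.exp (-(Real.log (y * (1 - m) / (m * (1 - y)))) * y) = Real.exp (-dKL y m) := by
  have h1m : 0 < 1 - m := sub_pos.2 hm1
  have h1y : 0 < 1 - y := sub_pos.2 hy
  have hval : m * (y * (1 - m) / (m * (1 - y))) + 1 - m
      = Real.exp (-Real.log ((1 - y) / (1 - m))) := by
    rw [Real.exp_neg, Real.exp_log (by positivity)]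
    field_simp
    ring
  have hlog : Real.log (y * (1 - m) / (m * (1 - y)))
      = Real.log (y / m) - Real.log ((1 - y) / (1 - m)) := by
    rw [← Real.log_div (by positivity) (by positivity)]
    congr 1
    field_simp
  rw [Real.exp_log (by positivity), hval, hlog, ← Real.exp_add, dKL]
  congr 1
  ring

/-- For `0 < m < y < 1`, the infimum over `t > 0` of `(m eᵗ + 1 - m) e^{-t y}` equals
`e^{-d_KL(y‖m)}`, and it is attained at `t = ln (y (1-m) / (m (1-y))) > 0`. -/
theorem chernoff_mgf_infimum (m y : ℝ) (hm : 0 < m) (hmy : m < y) (hy : y < 1) :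
    0 < Real.log (y * (1 - m) / (m * (1 - y))) ∧
    IsLeast ((fun t => (m * Real.exp t + 1 - m) * Real.exp (-t * y)) '' Set.Ioi (0 : ℝ))
      (Real.exp (-dKL y m)) ∧
    (m * Real.exp (Real.log (y * (1 - m) / (m * (1 - y)))) + 1 - m) *
        Real.exp (-(Real.log (y * (1 - m) / (m * (1 - y)))) * y) = Real.exp (-dKL y m) := by
  have hm1 : m < 1 := hmy.trans hy
  have hy0 : 0 < y := hm.trans hmy
  have hpos : 0 < Real.log (y * (1 - m) / (m * (1 - y))) := by
    apply Real.log_pos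
    rw [one_lt_div (mul_pos hm (sub_pos.2 hy))]
    linarith
  have heq := mgf_log_odds_ratio_eq hm hm1 hy0 hy
  refine ⟨hpos, ⟨⟨_, hpos, heq⟩, ?_⟩, heq⟩
  rintro _ ⟨t, -, rfl⟩
  exact exp_neg_dKL_le hm hm1 hy0 hy t

end
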